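/- For every integer n ≥ 3, the map sending (γ, k) ∈ Γ_{n-1} × ℤ to the block diagonal matrix whose upper-left (n-1)×(n-1) block is u₀^{-k}·γ and whose lower-right 1×1 block is u₀^{k(n-1)} is a well-defined injective group homomorphism from Γ_{n-1} × ℤ into Γ_n. -/

import Mathlib

open IntermediateField Polynomial Matrix

/-- The real fourth root of `2`. -/
noncomputable def alpha : ℝ := (2 : ℝ) ^ ((1 : ℝ) / 4)

/-- The number field `L = ℚ(2^{1/4})`, as a subfield of `ℝ`. -/
noncomputable def L : IntermediateField ℚ ℝ := ℚ⟮alpha⟯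

noncomputable def alphaL : L := ⟨alpha, IntermediateField.mem_adjoin_simple_self ℚ alpha⟩

/-- The unit `u₀ = (3 + 2√2) + (2 + 2√2)·α` of `O_L`. -/
noncomputable def u0 : L := (3 + 2 * alphaL ^ 2) + (2 + 2 * alphaL ^ 2) * alphaL

/-- The matrix `D_n = diag(-1, √2, ..., √2)` over `L`, where `√2 = α²`. -/
noncomputable def Dmat (n : ℕ) : Matrix (Fin n) (Fin n) L :=
  Matrix.diagonal fun i => if (i : ℕ) = 0 then -1 else alphaL ^ 2

/-- Membership in `Γ_n`: entries are algebraic integers, determinant is one, and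
`τ(gᵀ)·D_n·g = D_n`. -/
noncomputable def inGamma (n : ℕ) (τ : L ≃ₐ[ℚ] L) (h : Matrix (Fin n) (Fin n) L) : Prop :=
  (∀ i j, IsIntegral ℤ (h i j)) ∧ h.det = 1 ∧ (h.transpose.map τ) * Dmat n * h = Dmat n

/-- The block diagonal matrix with upper-left `(n-1)×(n-1)` block `u₀^{-k}·γ` and lower-right
`1×1` block `u₀^{k(n-1)}`. -/
noncomputable def Bmat (n : ℕ) (γ : Matrix (Fin (n-1)) (Fin (n-1)) L) (k : ℤ) :
    Matrix (Fin n) (Fin n) L := fun i j =>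
  if hi : (i : ℕ) < n - 1 then
    (if hj : (j : ℕ) < n - 1 then u0 ^ (-k) * γ ⟨i, hi⟩ ⟨j, hj⟩ else 0)
  else (if (j : ℕ) < n - 1 then 0 else u0 ^ (k * ((n : ℤ) - 1)))

theorem alphaL_pow : alphaL ^ 4 = 2 := by
  apply Subtype.ext
  change alpha ^ 4 = 2
  unfold alpha
  rw [← Real.rpow_natCast, ← Real.rpow_mul (by norm_num)]
  norm_num

theorem alphaL_integral : IsIntegral ℤ alphaL := by
  apply IsIntegral.of_pow (n := 4) (by norm_num)
  rw [alphaL_pow]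
  exact_mod_cast (isIntegral_algebraMap (R := ℤ) (A := L) (x := 2))

theorem ofNat_integral (k : ℕ) : IsIntegral ℤ (k : L) := by
  exact_mod_cast (isIntegral_algebraMap (R := ℤ) (A := L) (x := k))

theorem u0_integral : IsIntegral ℤ u0 := by
  have h2 : IsIntegral ℤ (2 : L) := by exact_mod_cast ofNat_integral 2
  have h3 : IsIntegral ℤ (3 : L) := by exact_mod_cast ofNat_integral 3
  have ha := alphaL_integral
  exact (h3.add (h2.mul (ha.pow 2))).add ((h2.add (h2.mul (ha.pow 2))).mul ha)

theorem tau_u0 (τ : L ≃ₐ[ℚ] L) (hτ : τ alphaL = -alphaL) : τ u0 * u0 = 1 := by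
  have h := alphaL_pow
  have e : τ u0 = (3 + 2 * alphaL ^ 2) - (2 + 2 * alphaL ^ 2) * alphaL := by
    simp only [u0, map_add, map_mul, map_pow, hτ, map_ofNat]
    ring
  rw [e, u0]
  linear_combination (-4 - 4 * alphaL ^ 2) * h

theorem u0_gt : 1 < (u0 : ℝ) := by
  have h : 0 < alpha := by unfold alpha; positivity
  have e : (u0 : ℝ) = (3 + 2 * alpha ^ 2) + (2 + 2 * alpha ^ 2) * alpha := rfl
  rw [e]
  have : 0 < (2 + 2 * alpha ^ 2) * alpha := by positivity
  nlinarith [sq_nonneg alpha]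

theorem u0_ne : u0 ≠ 0 := by
  intro h
  have := u0_gt
  rw [h] at this
  norm_num at this

theorem u0_zpow_inj {a b : ℤ} (h : u0 ^ a = u0 ^ b) : a = b := by
  have h' : (u0 : ℝ) ^ a = (u0 : ℝ) ^ b := by
    have := congrArg (algebraMap L ℝ) h
    rw [map_zpow₀, map_zpow₀] at this
    exact this
  exact zpow_right_injective₀ (by linarith [u0_gt]) (by linarith [u0_gt]) h'

theorem tau_u0_zpow (τ : L ≃ₐ[ℚ] L) (hτ : τ alphaL = -alphaL) (k : ℤ) :
    τ (u0 ^ k) * u0 ^ k = 1 := by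
  rw [map_zpow₀, ← mul_zpow, tau_u0 τ hτ, _root_.one_zpow]

theorem u0_zpow_integral (τ : L ≃ₐ[ℚ] L) (hτ : τ alphaL = -alphaL) (k : ℤ) :
    IsIntegral ℤ (u0 ^ k) := by
  have hi : IsIntegral ℤ (u0⁻¹) := by
    rw [← eq_inv_of_mul_eq_one_left (tau_u0 τ hτ)]
    exact u0_integral.map (τ.toAlgHom.restrictScalars ℤ)
  obtain ⟨m, rfl | rfl⟩ := k.eq_nat_or_neg
  · rw [zpow_natCast]; exact u0_integral.pow m
  · rw [_root_.zpow_neg, zpow_natCast, ← inv_pow]; exact hi.pow m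

theorem Bmat_eq (m : ℕ) (γ : Matrix (Fin m) (Fin m) L) (k : ℤ) :
    Bmat (m + 1) γ k = (fromBlocks (u0 ^ (-k) • γ) 0 0
      (u0 ^ (k * (m : ℤ)) • (1 : Matrix (Fin 1) (Fin 1) L))).submatrix
        finSumFinEquiv.symm finSumFinEquiv.symm := by
  ext1 i j
  obtain ⟨i, rfl⟩ := finSumFinEquiv.surjective i
  obtain ⟨j, rfl⟩ := finSumFinEquiv.surjective j
  rcases i with i | i <;> rcases j with j | j
  · simp [Bmat]
  · simp [Bmat]
  · simp [Bmat]
  · simp [Bmat, Subsingleton.elim i j]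

theorem Dmat_eq (m : ℕ) (hm : 0 < m) :
    Dmat (m + 1) = (fromBlocks (Dmat m) 0 0
      (alphaL ^ 2 • (1 : Matrix (Fin 1) (Fin 1) L))).submatrix
        finSumFinEquiv.symm finSumFinEquiv.symm := by
  ext1 i j
  obtain ⟨i, rfl⟩ := finSumFinEquiv.surjective i
  obtain ⟨j, rfl⟩ := finSumFinEquiv.surjective j
  rw [submatrix_apply, Equiv.symm_apply_apply, Equiv.symm_apply_apply, Dmat, diagonal_apply]
  rcases i with i | i <;> rcases j with j | j
  · rw [fromBlocks_apply₁₁, Dmat, diagonal_apply]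
    simp only [finSumFinEquiv_apply_left, Fin.val_castAdd, Fin.castAdd_inj]
    by_cases h : i = j <;> by_cases h0 : (i : ℕ) = 0 <;> simp only [h, h0, if_true, if_false] <;> split_ifs <;> simp_all
  · rw [fromBlocks_apply₁₂, if_neg (fun h => by cases finSumFinEquiv.injective h)]
    rfl
  · rw [fromBlocks_apply₂₁, if_neg (fun h => by cases finSumFinEquiv.injective h)]
    rfl
  · rw [fromBlocks_apply₂₂, Subsingleton.elim i j, if_pos rfl, if_neg, Matrix.smul_apply, one_apply_eq,
      smul_eq_mul, mul_one]
    rw [finSumFinEquiv_apply_right, Fin.val_natAdd]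
    omega

theorem Bmat_mem (m : ℕ) (hm : 0 < m) (τ : L ≃ₐ[ℚ] L) (hτ : τ alphaL = -alphaL)
    (γ : Matrix (Fin m) (Fin m) L) (k : ℤ) (h : inGamma m τ γ) :
    inGamma (m + 1) τ (Bmat (m + 1) γ k) := by
  obtain ⟨h1, h2, h3⟩ := h
  refine ⟨?_, ?_, ?_⟩
  · intro i j
    unfold Bmat
    split_ifs
    · exact (u0_zpow_integral τ hτ _).mul (h1 _ _)
    · exact isIntegral_zero
    · exact isIntegral_zero
    · exact u0_zpow_integral τ hτ _
  · rw [Bmat_eq, det_submatrix_equiv_self, det_fromBlocks_zero₂₁, det_smul, det_smul, h2]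
    simp only [Fintype.card_fin, det_one, mul_one, pow_one]
    rw [← zpow_natCast, ← _root_.zpow_mul, ← zpow_add₀ u0_ne]
    simp
  · have key : ∀ (p : ℕ) (c : ℤ) (A D : Matrix (Fin p) (Fin p) L),
        Aᵀ.map τ * D * A = D → (u0 ^ c • A)ᵀ.map τ * D * (u0 ^ c • A) = D := by
      intro p c A D hA
      have e : (u0 ^ c • A)ᵀ.map τ = τ (u0 ^ c) • Aᵀ.map τ := by
        ext i j; simp
      rw [e, smul_mul, smul_mul, Matrix.mul_smul, smul_smul, tau_u0_zpow τ hτ, one_smul, hA]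
    rw [Bmat_eq, Dmat_eq m hm, transpose_submatrix, ← submatrix_map, submatrix_mul_equiv,
      submatrix_mul_equiv, fromBlocks_transpose, fromBlocks_map, fromBlocks_multiply,
      fromBlocks_multiply]
    have a := key m (-k) γ (Dmat m) h3
    have b := key 1 (k * m) 1 (alphaL ^ 2 • 1) (by simp)
    have z1 : ((0 : Matrix (Fin m) (Fin 1) L)ᵀ).map τ = 0 := by ext; simp
    have z2 : ((0 : Matrix (Fin 1) (Fin m) L)ᵀ).map τ = 0 := by ext; simp
    simp only [z1, z2, Matrix.zero_mul, Matrix.mul_zero, add_zero, zero_add, a, b]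

theorem Bmat_mul (m : ℕ) (γ γ' : Matrix (Fin m) (Fin m) L) (k k' : ℤ) :
    Bmat (m + 1) (γ * γ' : Matrix (Fin m) (Fin m) L) (k + k')
      = Bmat (m + 1) γ k * Bmat (m + 1) γ' k' := by
  rw [Bmat_eq, Bmat_eq, Bmat_eq, submatrix_mul_equiv, fromBlocks_multiply]
  simp only [Matrix.zero_mul, Matrix.mul_zero, add_zero, zero_add, smul_mul, Matrix.mul_smul, smul_smul,
    Matrix.mul_one]
  rw [← zpow_add₀ u0_ne, ← zpow_add₀ u0_ne, neg_add, add_mul, smul_zero, smul_zero,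
    add_comm (-k), add_comm (k * (m : ℤ))]

theorem Bmat_inj (m : ℕ) (hm : 0 < m) (γ γ' : Matrix (Fin m) (Fin m) L) (k k' : ℤ)
    (h : Bmat (m + 1) γ k = Bmat (m + 1) γ' k') : γ = γ' ∧ k = k' := by
  have hk : k = k' := by
    have := congrFun (congrFun h (Fin.last m)) (Fin.last m)
    simp [Bmat] at this
    have := u0_zpow_inj this
    exact mul_right_cancel₀ (by exact_mod_cast hm.ne') this
  subst hk
  refine ⟨?_, rfl⟩
  ext1 i j
  have := congrFun (congrFun h i.castSucc) j.castSucc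
  simpa [Bmat, u0_ne, zpow_ne_zero] using this

/-- For `n ≥ 3`, the map `(γ, k) ↦ Bmat n γ k` is a well-defined injective group homomorphism
from `Γ_{n-1} × ℤ` into `Γ_n`. -/
theorem stmt9 (n : ℕ) (hn : 3 ≤ n) (τ : L ≃ₐ[ℚ] L) (hτ : τ alphaL = -alphaL) :
    (∀ (γ : Matrix (Fin (n-1)) (Fin (n-1)) L) (k : ℤ),
        inGamma (n-1) τ γ → inGamma n τ (Bmat n γ k)) ∧
    (∀ (γ γ' : Matrix (Fin (n-1)) (Fin (n-1)) L) (k k' : ℤ),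
        inGamma (n-1) τ γ → inGamma (n-1) τ γ' →
        Bmat n (γ * γ') (k + k') = Bmat n γ k * Bmat n γ' k') ∧
    (∀ (γ γ' : Matrix (Fin (n-1)) (Fin (n-1)) L) (k k' : ℤ),
        inGamma (n-1) τ γ → inGamma (n-1) τ γ' →
        Bmat n γ k = Bmat n γ' k' → γ = γ' ∧ k = k') := by
  obtain ⟨m, rfl⟩ : ∃ m, n = m + 1 := ⟨n - 1, by omega⟩
  have hm : 0 < m := by omega
  exact ⟨fun γ k h => Bmat_mem m hm τ hτ γ k h,
    fun γ γ' k k' _ _ => Bmat_mul m γ γ' k k',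
    fun γ γ' k k' _ _ h => Bmat_inj m hm γ γ' k k' h⟩
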